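/- arXiv:0712.0379 — 2 statements merged into one kernel-verified Lean document; each statement's English description precedes it below -/
import Mathlib

section
/- Let m ≥ 1 be an integer and define G_m(t) = ∑_{l=1}^{2m+1} ∑_{i=0}^{l−1} ∑_{j=0}^{2m+1+i−l} ∑_{k=0}^{l−1−i} (−1)^{j+k+l} · C(2m+1,l) · Ch(−2m−1, j) · Ch(−2m−1, k) · Ch(2m−t, j+k+2m+1) · Ch(t, i−j−l+2m+1) · Ch(t, l−k−1−i) for integers t. Then there exists a rational constant A_m such that for every integer t, G_m(t) = A_m · Ch(t+m, 4m+1). -/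
open Finset

/-- Generalized binomial coefficient `Ch(x,r) = x(x-1)⋯(x-r+1)/r!`. -/
def gch (x : ℚ) (r : ℕ) : ℚ :=
  (∏ j ∈ Finset.range r, (x - (j : ℚ))) / (Nat.factorial r : ℚ)

/-- The quadruple sum `G_m(t)` from the Appendix. -/
def Gfun (m : ℕ) (t : ℚ) : ℚ :=
  ∑ l ∈ Finset.Icc 1 (2 * m + 1), ∑ i ∈ Finset.range l,
    ∑ j ∈ Finset.range (2 * m + 1 + i - l + 1), ∑ k ∈ Finset.range (l - i),
      (-1 : ℚ) ^ (j + k + l) * (Nat.choose (2 * m + 1) l : ℚ)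
        * gch (-(2 * (m : ℚ) + 1)) j * gch (-(2 * (m : ℚ) + 1)) k
        * gch (2 * (m : ℚ) - t) (j + k + 2 * m + 1)
        * gch t (i + 2 * m + 1 - j - l) * gch t (l - k - 1 - i)

theorem gch_eq_choose (x : ℚ) (r : ℕ) : gch x r = Ring.choose x r := by
  rw [Ring.choose_eq_smul, ← Polynomial.aeval_eq_smeval, ← Polynomial.eval_map_algebraMap,
    descPochhammer_map, descPochhammer_eval_eq_prod_range, smul_eq_mul, gch, div_eq_inv_mul]

theorem gch_natCast (a r : ℕ) : gch (a : ℚ) r = (a.choose r : ℚ) := by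
  rw [gch_eq_choose, Ring.choose_natCast]

theorem gch_natCast_eq_zero {x : ℚ} (a : ℕ) {r : ℕ} (hx : x = a) (h : a < r) : gch x r = 0 := by
  rw [hx, gch_natCast, Nat.choose_eq_zero_of_lt h, Nat.cast_zero]

theorem gch_add (x y : ℚ) (r : ℕ) :
    gch (x + y) r = ∑ ij ∈ antidiagonal r, gch x ij.1 * gch y ij.2 := by
  simp only [gch_eq_choose]
  exact Ring.add_choose_eq r (Commute.all x y)

theorem choose_mul_gch (x : ℚ) {n k : ℕ} (h : k ≤ n) :
    (n.choose k : ℚ) * gch x n = gch x k * gch (x - k) (n - k) := by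
  simp only [gch_eq_choose]
  rw [← Ring.choose_smul_choose x h, nsmul_eq_mul]

theorem gch_neg_succ (u r : ℕ) :
    gch (-((u : ℚ) + 1)) r = (-1) ^ r * ((u + r).choose u : ℚ) := by
  have h : (u : ℚ) + 1 + r - 1 = ((u + r : ℕ) : ℚ) := by push_cast; ring
  rw [gch_eq_choose, Ring.choose_neg, h, Ring.choose_natCast, Int.negOnePow_def,
    Nat.choose_symm_add]
  simp [Units.smul_def]

/-- `f` is a polynomial function of degree at most `d`. -/
def IsPolyOfDegreeLE (d : ℕ) (f : ℚ → ℚ) : Prop :=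
  ∃ P : Polynomial ℚ, P.natDegree ≤ d ∧ ∀ x, P.eval x = f x

namespace IsPolyOfDegreeLE

theorem mono {d e : ℕ} {f : ℚ → ℚ} (hf : IsPolyOfDegreeLE d f) (h : d ≤ e) :
    IsPolyOfDegreeLE e f := by
  obtain ⟨P, hP, hPf⟩ := hf
  exact ⟨P, hP.trans h, hPf⟩

theorem const_mul {d : ℕ} {f : ℚ → ℚ} (c : ℚ) (hf : IsPolyOfDegreeLE d f) :
    IsPolyOfDegreeLE d fun x ↦ c * f x := by
  obtain ⟨P, hP, hPf⟩ := hf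
  exact ⟨Polynomial.C c * P, (Polynomial.natDegree_C_mul_le _ _).trans hP, by simp [hPf]⟩

theorem mul {d e : ℕ} {f g : ℚ → ℚ} (hf : IsPolyOfDegreeLE d f) (hg : IsPolyOfDegreeLE e g) :
    IsPolyOfDegreeLE (d + e) fun x ↦ f x * g x := by
  obtain ⟨P, hP, hPf⟩ := hf
  obtain ⟨Q, hQ, hQg⟩ := hg
  exact ⟨P * Q, Polynomial.natDegree_mul_le_of_le hP hQ, by simp [hPf, hQg]⟩

theorem sum {ι : Type*} {d : ℕ} (s : Finset ι) {f : ι → ℚ → ℚ}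
    (hf : ∀ i ∈ s, IsPolyOfDegreeLE d (f i)) : IsPolyOfDegreeLE d fun x ↦ ∑ i ∈ s, f i x := by
  choose! P hP hPf using hf
  refine ⟨∑ i ∈ s, P i, Polynomial.natDegree_sum_le_of_forall_le s P hP, fun x ↦ ?_⟩
  rw [Polynomial.eval_finsetSum]
  exact sum_congr rfl fun i hi ↦ hPf i hi x

theorem gch_linear (a b : ℚ) (r : ℕ) : IsPolyOfDegreeLE r fun x ↦ gch (a * x + b) r := by
  refine ⟨Polynomial.C (r.factorial : ℚ)⁻¹ *
    ∏ j ∈ range r, (Polynomial.C a * Polynomial.X + Polynomial.C (b - j)), ?_, fun x ↦ ?_⟩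
  · refine (Polynomial.natDegree_C_mul_le _ _).trans ((Polynomial.natDegree_prod_le _ _).trans ?_)
    refine (sum_le_card_nsmul _ _ 1 fun j _ ↦ Polynomial.natDegree_linear_le).trans ?_
    simp
  · simp only [Polynomial.eval_mul, Polynomial.eval_C, Polynomial.eval_prod, Polynomial.eval_add,
      Polynomial.eval_X, gch, add_sub_assoc]
    ring

theorem eq_of_eval_eq {d : ℕ} {f g : ℚ → ℚ} (hf : IsPolyOfDegreeLE d f)
    (hg : IsPolyOfDegreeLE d g) (s : Finset ℚ) (hs : d < #s) (h : ∀ x ∈ s, f x = g x) : f = g := by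
  obtain ⟨P, hP, hPf⟩ := hf
  obtain ⟨Q, hQ, hQg⟩ := hg
  have key : P = Q := by
    refine Polynomial.eq_of_degrees_lt_of_eval_finset_eq s ?_ ?_ fun x hx ↦ ?_
    · exact Polynomial.degree_le_natDegree.trans_lt (by exact_mod_cast hP.trans_lt hs)
    · exact Polynomial.degree_le_natDegree.trans_lt (by exact_mod_cast hQ.trans_lt hs)
    · rw [hPf, hQg, h x hx]
  funext x
  rw [← hPf, ← hQg, key]

theorem alternating_sum_choose_mul_eq_zero {d n : ℕ} {f : ℚ → ℚ} (hf : IsPolyOfDegreeLE d f)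
    (h : d < n) : ∑ p ∈ range (n + 1), (-1 : ℚ) ^ p * (n.choose p : ℚ) * f p = 0 := by
  obtain ⟨P, hP, hPf⟩ := hf
  have key := congrFun (Polynomial.fwdDiff_iter_eq_zero_of_degree_lt (hP.trans_lt h)) 0
  rw [fwdDiff_iter_eq_sum_shift] at key
  have hsign : ∀ p ∈ range (n + 1), (-1 : ℚ) ^ p * (n.choose p : ℚ) * f p =
      (-1) ^ n * (((-1 : ℤ) ^ (n - p) * n.choose p) • P.eval (0 + p • (1 : ℚ))) := by
    intro p hp
    obtain ⟨q, rfl⟩ := Nat.exists_eq_add_of_le (Nat.lt_succ_iff.mp (mem_range.mp hp))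
    have hq : (-1 : ℚ) ^ q * (-1) ^ q = 1 := by rw [← mul_pow]; norm_num
    simp only [Nat.add_sub_cancel_left, zsmul_eq_mul, zero_add, nsmul_eq_mul, mul_one, hPf]
    push_cast
    linear_combination (-(-1 : ℚ) ^ p * ((p + q).choose p : ℚ) * f p) * hq
  rw [sum_congr rfl hsign, ← mul_sum, key, Pi.zero_apply, mul_zero]

end IsPolyOfDegreeLE

theorem sum_Icc_alternating_choose (N p : ℕ) (hp : p ≤ N) :
    ∑ l ∈ Finset.Icc (p + 1) (N + 1), (-1 : ℚ) ^ l * ((N + 1).choose l : ℚ) =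
      -((-1) ^ p * (N.choose p : ℚ)) := by
  have h1 := Int.alternating_sum_range_choose_of_ne N.succ_ne_zero
  have h2 := Int.alternating_sum_range_choose_eq_choose (n := N) (m := p)
  have h3 := sum_range_add_sum_Ico (fun l ↦ ((-1) ^ l * (N + 1).choose l : ℤ))
    (show p + 1 ≤ N + 1 + 1 by omega)
  have h4 : ∑ l ∈ Finset.Icc (p + 1) (N + 1), ((-1) ^ l * (N + 1).choose l : ℤ) =
      -((-1) ^ p * (N.choose p)) := by
    rw [← Ico_add_one_right_eq_Icc]
    simp only [Nat.succ_eq_add_one] at h1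
    linarith
  exact_mod_cast h4

/-- The summand of `Gfun` after summing over `l` with `p = l - 1 - i` fixed, `N = 2m`. -/
def reducedTerm (N : ℕ) (t : ℚ) (p j k : ℕ) : ℚ :=
  (-1) ^ (j + k) * gch (-((N : ℚ) + 1)) j * gch (-((N : ℚ) + 1)) k
    * gch (N - t) (j + k + N + 1) * gch t (N - p - j) * gch t (p - k)

theorem Gfun_eq (m : ℕ) (t : ℚ) :
    Gfun m t = -∑ p ∈ range (2 * m + 1), (-1) ^ p * ((2 * m).choose p : ℚ) *
      ∑ j ∈ range (2 * m - p + 1), ∑ k ∈ range (p + 1), reducedTerm (2 * m) t p j k := by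
  have h1 : Gfun m t = ∑ l ∈ Finset.Icc 1 (2 * m + 1), ∑ p ∈ range l,
      (-1) ^ l * ((2 * m + 1).choose l : ℚ) *
      ∑ j ∈ range (2 * m - p + 1), ∑ k ∈ range (p + 1), reducedTerm (2 * m) t p j k := by
    refine sum_congr rfl fun l hl ↦ ?_
    rw [← sum_range_reflect]
    refine sum_congr rfl fun i hi ↦ ?_
    rw [mem_Icc] at hl
    rw [mem_range] at hi
    rw [mul_sum]
    refine sum_congr (by congr 1; omega) fun j hj ↦ ?_
    rw [mul_sum]
    refine sum_congr (by congr 1; omega) fun k hk ↦ ?_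
    rw [reducedTerm, show l - k - 1 - (l - 1 - i) = i - k by omega,
      show l - 1 - i + 2 * m + 1 - j - l = 2 * m - i - j by omega]
    push_cast
    ring
  rw [h1, ← sum_neg_distrib,
    sum_comm' (t' := range (2 * m + 1)) (s' := fun p ↦ Finset.Icc (p + 1) (2 * m + 1))
      (by intro l p; simp only [mem_Icc, mem_range]; omega)]
  refine sum_congr rfl fun p hp ↦ ?_
  rw [← sum_mul, sum_Icc_alternating_choose _ _ (Nat.lt_succ_iff.mp (mem_range.mp hp)), neg_mul]

theorem isPolyOfDegreeLE_Gfun (m : ℕ) : IsPolyOfDegreeLE (4 * m + 1) (Gfun m) := by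
  have : Gfun m = fun t ↦ (-1) * ∑ p ∈ range (2 * m + 1), (-1) ^ p * ((2 * m).choose p : ℚ) *
      ∑ j ∈ range (2 * m - p + 1), ∑ k ∈ range (p + 1), reducedTerm (2 * m) t p j k := by
    funext t
    rw [Gfun_eq, neg_one_mul]
  rw [this]
  refine .const_mul _ (.sum _ fun p hp ↦ .const_mul _ (.sum _ fun j hj ↦ .sum _ fun k hk ↦ ?_))
  rw [mem_range] at hp hj hk
  have h := ((IsPolyOfDegreeLE.gch_linear (-1) ((2 * m : ℕ) : ℚ) (j + k + 2 * m + 1)).const_mul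
    ((-1) ^ (j + k) * gch (-(((2 * m : ℕ) : ℚ) + 1)) j * gch (-(((2 * m : ℕ) : ℚ) + 1)) k)).mul
    ((IsPolyOfDegreeLE.gch_linear 1 0 (2 * m - p - j)).mul
      (IsPolyOfDegreeLE.gch_linear 1 0 (p - k)))
  convert h.mono (e := 4 * m + 1) (by omega) using 2 with t
  rw [reducedTerm, show -1 * t + ((2 * m : ℕ) : ℚ) = ((2 * m : ℕ) : ℚ) - t by ring,
    show 1 * t + 0 = t by ring]
  ring

theorem reducedTerm_eq_zero {N a : ℕ} (ha : a ≤ N) (p j k : ℕ) : reducedTerm N a p j k = 0 := by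
  have h : gch ((N : ℚ) - a) (j + k + N + 1) = 0 :=
    gch_natCast_eq_zero (N - a) (by rw [Nat.cast_sub ha]) (by omega)
  rw [reducedTerm, h]
  ring

/-- A weighted Chu-Vandermonde convolution whose total upper argument is a small natural number. -/
theorem sum_choose_mul_gch_eq_zero (N u a q : ℕ) (ha : a ≤ u) (hq : u < q) :
    ∑ j ∈ range (q + 1),
      (j.choose a : ℚ) * gch (-((N : ℚ) + 1)) j * gch ((N : ℚ) + 1 + u) (q - j) = 0 := by
  have haq : a + (q - a) = q := by omega
  have h0 : gch ((-((N : ℚ) + 1) - a) + ((N : ℚ) + 1 + u)) (q - a) = 0 :=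
    gch_natCast_eq_zero (u - a) (by rw [Nat.cast_sub ha]; ring) (by omega)
  rw [gch_add, Nat.sum_antidiagonal_eq_sum_range_succ
    (fun i j ↦ gch (-((N : ℚ) + 1) - a) i * gch ((N : ℚ) + 1 + u) j)] at h0
  rw [show q + 1 = a + (q - a).succ by omega, sum_range_add, sum_eq_zero, zero_add]
  · rw [← mul_zero (gch (-((N : ℚ) + 1)) a), ← h0, mul_sum]
    refine sum_congr rfl fun j _ ↦ ?_
    rw [choose_mul_gch _ (Nat.le_add_right a j), Nat.add_sub_cancel_left, Nat.sub_sub]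
    ring
  · intro j hj
    rw [Nat.choose_eq_zero_of_lt (mem_range.mp hj)]
    simp

theorem sum_reducedTerm_eq_zero {N u p : ℕ} (h : 2 * u < N) (hp : p ≤ N) :
    ∑ j ∈ range (N - p + 1), ∑ k ∈ range (p + 1), reducedTerm N ((N : ℚ) + 1 + u) p j k = 0 := by
  have key : ∀ j k, reducedTerm N ((N : ℚ) + 1 + u) p j k =
      ∑ ae ∈ antidiagonal u, ∑ bf ∈ antidiagonal ae.2,
        (-1) ^ (N + 1) * ((u + N + 1).choose bf.2 : ℚ) *
        ((j.choose ae.1 : ℚ) * gch (-((N : ℚ) + 1)) j * gch ((N : ℚ) + 1 + u) (N - p - j)) *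
        ((k.choose bf.1 : ℚ) * gch (-((N : ℚ) + 1)) k * gch ((N : ℚ) + 1 + u) (p - k)) := by
    intro j k
    have h1 : (u + (j + k + N + 1)).choose u = ∑ ae ∈ antidiagonal u, ∑ bf ∈ antidiagonal ae.2,
        j.choose ae.1 * (k.choose bf.1 * (u + N + 1).choose bf.2) := by
      rw [show u + (j + k + N + 1) = j + (k + (u + N + 1)) by ring, Nat.add_choose_eq]
      simp only [Nat.add_choose_eq k, mul_sum]
    have h2 : (-1 : ℚ) ^ (j + k) * (-1) ^ (j + k) = 1 := by rw [← mul_pow]; norm_num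
    rw [reducedTerm, show (N : ℚ) - (N + 1 + u) = -((u : ℚ) + 1) by ring, gch_neg_succ u, h1,
      show j + k + N + 1 = (j + k) + (N + 1) by ring, pow_add]
    push_cast
    trans (∑ ae ∈ antidiagonal u, ∑ bf ∈ antidiagonal ae.2,
      (j.choose ae.1 : ℚ) * ((k.choose bf.1 : ℚ) * ((u + N + 1).choose bf.2 : ℚ))) *
      ((-1) ^ (N + 1) * (gch (-((N : ℚ) + 1)) j * gch ((N : ℚ) + 1 + u) (N - p - j)) *
        (gch (-((N : ℚ) + 1)) k * gch ((N : ℚ) + 1 + u) (p - k)))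
    · linear_combination (∑ ae ∈ antidiagonal u, ∑ bf ∈ antidiagonal ae.2,
        (j.choose ae.1 : ℚ) * ((k.choose bf.1 : ℚ) * ((u + N + 1).choose bf.2 : ℚ))) *
        ((-1) ^ (N + 1) * (gch (-((N : ℚ) + 1)) j * gch ((N : ℚ) + 1 + u) (N - p - j)) *
        (gch (-((N : ℚ) + 1)) k * gch ((N : ℚ) + 1 + u) (p - k))) * h2
    · simp only [sum_mul]
      exact sum_congr rfl fun _ _ ↦ sum_congr rfl fun _ _ ↦ by ring
  simp only [key]
  rw [sum_congr rfl fun j _ ↦ sum_comm, sum_comm]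
  refine sum_eq_zero fun ae hae ↦ ?_
  rw [sum_congr rfl fun j _ ↦ sum_comm, sum_comm]
  refine sum_eq_zero fun bf hbf ↦ ?_
  rw [HasAntidiagonal.mem_antidiagonal] at hae hbf
  simp only [← mul_sum, ← sum_mul]
  rcases lt_or_ge u p with hup | hup
  · rw [sum_choose_mul_gch_eq_zero N u bf.1 p (by omega) hup, mul_zero]
  · rw [sum_choose_mul_gch_eq_zero N u ae.1 (N - p) (by omega) (by omega), mul_zero, zero_mul]

/-- At `t = -(u + 1)` the truncation of the inner sums is automatic once the summand is extended
polynomially in `p`. -/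
theorem reducedTerm_neg_eq {N u p : ℕ} (hp : p ≤ N) (j k : ℕ) :
    (if j ≤ N - p ∧ k ≤ p then reducedTerm N (-((u : ℚ) + 1)) p j k else 0) =
      (-1) ^ N * gch (-((N : ℚ) + 1)) j * gch (-((N : ℚ) + 1)) k
        * gch ((N : ℚ) + u + 1) (j + k + N + 1)
        * (gch ((-1) * (p : ℚ) + (N - j + u)) u * gch (1 * (p : ℚ) + (u - k)) u) := by
  split_ifs with h
  · obtain ⟨b, rfl⟩ := Nat.exists_eq_add_of_le h.2
    obtain ⟨a, ha⟩ := Nat.exists_eq_add_of_le h.1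
    obtain rfl : N = k + b + (j + a) := by omega
    rw [reducedTerm, show k + b + (j + a) - (k + b) - j = a by omega, Nat.add_sub_cancel_left,
      gch_neg_succ u a, gch_neg_succ u b, ← gch_natCast, ← gch_natCast]
    push_cast
    ring_nf
  · rcases lt_or_ge u (j + k) with hjk | hjk
    · rw [gch_natCast_eq_zero (N + u + 1) (r := j + k + N + 1) (by push_cast; ring) (by omega)]
      ring
    · rcases lt_or_ge p k with hk | hk
      · rw [gch_natCast_eq_zero (p + u - k) (x := 1 * (p : ℚ) + (u - k))
          (by rw [Nat.cast_sub (by omega)]; push_cast; ring) (by omega)]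
        ring
      · rw [gch_natCast_eq_zero (N - p + u - j) (x := (-1) * (p : ℚ) + (N - j + u))
          (by rw [Nat.cast_sub (by omega), Nat.cast_add, Nat.cast_sub hp]; ring) (by omega)]
        ring

theorem Gfun_neg_eq_zero {m u : ℕ} (h : u < m) : Gfun m (-((u : ℚ) + 1)) = 0 := by
  have extend : ∀ p ∈ range (2 * m + 1),
      ∑ j ∈ range (2 * m - p + 1), ∑ k ∈ range (p + 1),
        reducedTerm (2 * m) (-((u : ℚ) + 1)) p j k =
      ∑ j ∈ range (2 * m + 1), ∑ k ∈ range (2 * m + 1),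
        if j ≤ 2 * m - p ∧ k ≤ p then reducedTerm (2 * m) (-((u : ℚ) + 1)) p j k else 0 := by
    intro p hp
    rw [mem_range] at hp
    rw [← sum_product', ← sum_product', ← sum_filter]
    refine sum_congr ?_ fun _ _ ↦ rfl
    ext ⟨j, k⟩
    simp only [mem_product, mem_filter, mem_range]
    omega
  rw [Gfun_eq, neg_eq_zero, sum_congr rfl fun p hp ↦ by rw [extend p hp]]
  simp only [mul_sum]
  rw [sum_comm]
  refine sum_eq_zero fun j _ ↦ ?_
  rw [sum_comm]
  refine sum_eq_zero fun k _ ↦ ?_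
  have hpoly := ((IsPolyOfDegreeLE.gch_linear (-1) (((2 * m : ℕ) : ℚ) - j + u) u).mul
    (IsPolyOfDegreeLE.gch_linear 1 ((u : ℚ) - k) u)).const_mul
    ((-1) ^ (2 * m) * gch (-(((2 * m : ℕ) : ℚ) + 1)) j * gch (-(((2 * m : ℕ) : ℚ) + 1)) k
      * gch (((2 * m : ℕ) : ℚ) + u + 1) (j + k + 2 * m + 1))
  refine (sum_congr rfl fun p hp ↦ ?_).trans
    (hpoly.alternating_sum_choose_mul_eq_zero (n := 2 * m) (by omega))
  rw [reducedTerm_neg_eq (Nat.lt_succ_iff.mp (mem_range.mp hp))]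

theorem Gfun_eq_zero {m : ℕ} {t : ℤ} (h1 : -(m : ℤ) ≤ t) (h2 : t ≤ 3 * m) :
    Gfun m (t : ℚ) = 0 := by
  rcases lt_or_ge t 0 with h | h
  · obtain ⟨u, rfl⟩ : ∃ u : ℕ, t = -((u : ℤ) + 1) := ⟨(-t - 1).toNat, by omega⟩
    push_cast
    exact Gfun_neg_eq_zero (by omega)
  rw [Gfun_eq, neg_eq_zero]
  refine sum_eq_zero fun p hp ↦ mul_eq_zero_of_right _ ?_
  lift t to ℕ using h
  rcases le_or_gt t (2 * m) with ht | ht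
  · exact sum_eq_zero fun j _ ↦ sum_eq_zero fun k _ ↦ by
      simpa using reducedTerm_eq_zero ht p j k
  · obtain ⟨u, rfl⟩ := Nat.exists_eq_add_of_lt ht
    have := sum_reducedTerm_eq_zero (N := 2 * m) (u := u) (p := p) (by omega)
      (Nat.lt_succ_iff.mp (mem_range.mp hp))
    rw [show (((2 * m + u + 1 : ℕ) : ℤ) : ℚ) = ((2 * m : ℕ) : ℚ) + 1 + u by push_cast; ring]
    exact this

/-- there is a rational constant `A_m` with
`G_m(t) = A_m · Ch(t+m, 4m+1)` for every integer `t`. -/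
theorem stmt_12 (m : ℕ) (hm : 1 ≤ m) :
    ∃ A : ℚ, ∀ t : ℤ, Gfun m (t : ℚ) = A * gch ((t : ℚ) + m) (4 * m + 1) := by
  refine ⟨Gfun m (3 * m + 1), fun t ↦ ?_⟩
  have hpoly : IsPolyOfDegreeLE (4 * m + 1)
      fun x ↦ Gfun m (3 * m + 1) * gch (x + m) (4 * m + 1) := by
    simpa using (IsPolyOfDegreeLE.gch_linear 1 m (4 * m + 1)).const_mul (Gfun m (3 * m + 1))
  refine congrFun ((isPolyOfDegreeLE_Gfun m).eq_of_eval_eq hpoly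
    ((range (4 * m + 2)).image fun a : ℕ ↦ (a : ℚ) - m) ?_ ?_) t
  · rw [card_image_of_injective _ fun a b hab ↦ by simpa using hab, card_range]
    omega
  · simp only [mem_image, mem_range, forall_exists_index, and_imp]
    rintro _ a ha rfl
    rw [sub_add_cancel, gch_natCast]
    rcases Nat.lt_succ_iff_lt_or_eq.mp ha with ha | rfl
    · rw [Nat.choose_eq_zero_of_lt ha, Nat.cast_zero, mul_zero]
      simpa using Gfun_eq_zero (m := m) (t := (a : ℤ) - m) (by omega) (by omega)
    · rw [Nat.choose_self, Nat.cast_one, mul_one]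
      congr 1
      push_cast
      ring
end

section
/- For every real number q with 0 < q < 1, q^{−1/16} · ( ∏_{n=1}^{∞} (1 + q^{n−1/2}) / ∏_{n=1}^{∞} (1 − q^{n}) ) · ∑_{n∈ℤ} q^{(3n+1)²/6} = ( q^{5/48} / ∏_{n=1}^{∞}(1 + q^{n}) ) · ∑_{(m₁,m₂)} (−q^{1/2}; q^{1/2})_{m₁} · (−q^{1/2}; q^{1/2})_{m₂} · q^{ 3(m₁−m₂)²/8 + (m₁−m₂)/2 + m₁m₂/2 } / ( (q; q)_{m₁} · (q; q)_{m₂} ), where the last sum runs over all pairs of nonnegative integers (m₁,m₂) with m₁ ≡ m₂ (mod 2), and all series and products converge absolutely. (The left-hand side equals (𝔣(τ)/η(τ))·Θ_{1,3/2}(τ) up to the stated powers of q.) -/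
open Finset

/-- q-Pochhammer symbol `(a; x)_n = ∏_{j=0}^{n-1} (1 - a x^j)`. -/
def qPoch (a x : ℝ) (n : ℕ) : ℝ :=
  ∏ j ∈ Finset.range n, (1 - a * x ^ j)

section QSeries

open Filter Topology

variable {x : ℝ}

theorem qPoch_succ (a x : ℝ) (n : ℕ) : qPoch a x (n + 1) = qPoch a x n * (1 - a * x ^ n) :=
  Finset.prod_range_succ _ _

theorem qPoch_self (x : ℝ) (n : ℕ) : qPoch x x n = ∏ j ∈ Finset.range n, (1 - x ^ (j + 1)) := by
  simp only [qPoch, pow_succ']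

theorem qPoch_neg_mul_qPoch (x : ℝ) (n : ℕ) :
    qPoch (-x) x n * qPoch x x n = qPoch (x ^ 2) (x ^ 2) n := by
  simp only [qPoch, ← Finset.prod_mul_distrib]
  exact Finset.prod_congr rfl fun j _ => by ring

theorem qPoch_self_pos (h0 : 0 < x) (h1 : x < 1) (n : ℕ) : 0 < qPoch x x n := by
  rw [qPoch_self]
  exact Finset.prod_pos fun j _ => sub_pos.2 (pow_lt_one₀ h0.le h1 (by simp))

theorem qPoch_neg_pos (h0 : 0 < x) (n : ℕ) : 0 < qPoch (-x) x n :=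
  Finset.prod_pos fun j _ => by
    have := pow_pos h0 j
    nlinarith [mul_pos h0 this]

theorem summable_pow_succ (h0 : 0 < x) (h1 : x < 1) : Summable fun n : ℕ => x ^ (n + 1) :=
  (summable_nat_add_iff 1).2 (summable_geometric_of_lt_one h0.le h1)

theorem multipliable_one_add_pow_succ (h0 : 0 < x) (h1 : x < 1) :
    Multipliable fun n : ℕ => 1 + x ^ (n + 1) :=
  Real.multipliable_one_add_of_summable (summable_pow_succ h0 h1)

theorem multipliable_one_sub_pow_succ (h0 : 0 < x) (h1 : x < 1) :
    Multipliable fun n : ℕ => 1 - x ^ (n + 1) := by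
  simpa only [sub_eq_add_neg] using
    Real.multipliable_one_add_of_summable (summable_pow_succ h0 h1).neg

theorem tendsto_qPoch_self (h0 : 0 < x) (h1 : x < 1) :
    Tendsto (qPoch x x) atTop (𝓝 (∏' n : ℕ, (1 - x ^ (n + 1)))) := by
  have := (multipliable_one_sub_pow_succ h0 h1).tendsto_prod_tprod_nat
  simpa only [← qPoch_self] using this

theorem antitone_qPoch_self (h0 : 0 < x) (h1 : x < 1) : Antitone (qPoch x x) := by
  refine antitone_nat_of_succ_le fun n => ?_
  rw [qPoch_succ]
  have := qPoch_self_pos h0 h1 n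
  have := mul_pos h0 (pow_pos h0 n)
  nlinarith

theorem tprod_one_sub_pow_succ_pos (h0 : 0 < x) (h1 : x < 1) :
    0 < ∏' n : ℕ, (1 - x ^ (n + 1)) := by
  refine lt_of_le_of_ne (ge_of_tendsto' (tendsto_qPoch_self h0 h1)
    fun n => (qPoch_self_pos h0 h1 n).le) (Ne.symm ?_)
  have := tprod_one_add_ne_zero_of_summable (f := fun n : ℕ => -x ^ (n + 1))
    (fun n => by
      have : x ^ (n + 1) < 1 := pow_lt_one₀ h0.le h1 (by simp)
      rw [← sub_eq_add_neg]
      exact (sub_pos.2 this).ne')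
    (summable_pow_succ h0 h1).neg.norm
  simpa only [sub_eq_add_neg] using this

theorem tprod_le_qPoch_self (h0 : 0 < x) (h1 : x < 1) (n : ℕ) :
    ∏' n : ℕ, (1 - x ^ (n + 1)) ≤ qPoch x x n :=
  (antitone_qPoch_self h0 h1).le_of_tendsto (tendsto_qPoch_self h0 h1) n

/-- The numerator `∏_{j=0}^{m-1} (1 - x^{N-j})` of the Gaussian binomial coefficient
`[N choose m]`, which vanishes for `m > N`. -/
def gaussNum (x : ℝ) (N m : ℕ) : ℝ :=
  ∏ j ∈ Finset.range m, (1 - x ^ (N - j))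

theorem gaussNum_succ (x : ℝ) (N m : ℕ) :
    gaussNum x N (m + 1) = gaussNum x N m * (1 - x ^ (N - m)) :=
  Finset.prod_range_succ _ _

theorem gaussNum_eq_zero (x : ℝ) {N m : ℕ} (h : N < m) : gaussNum x N m = 0 :=
  Finset.prod_eq_zero (Finset.mem_range.2 h) (by simp)

theorem gaussNum_succ_succ (x : ℝ) (N m : ℕ) :
    gaussNum x (N + 1) (m + 1) = (1 - x ^ (N + 1)) * gaussNum x N m := by
  simp only [gaussNum, Finset.prod_range_succ', Nat.add_sub_add_right, Nat.sub_zero]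
  ring

/-- Pascal's rule for Gaussian binomial coefficients. -/
theorem gaussNum_pascal (x : ℝ) (N m : ℕ) :
    gaussNum x (N + 1) (m + 1) =
      gaussNum x N (m + 1) + x ^ (N - m) * (1 - x ^ (m + 1)) * gaussNum x N m := by
  rw [gaussNum_succ_succ, gaussNum_succ]
  rcases lt_or_ge N m with h | h
  · simp [gaussNum_eq_zero x h]
  · have : x ^ (N + 1) = x ^ (N - m) * x ^ (m + 1) := by
      rw [← pow_add]; congr 1; omega
    rw [this]; ring

theorem gaussNum_nonneg (h0 : 0 < x) (h1 : x < 1) (N m : ℕ) : 0 ≤ gaussNum x N m :=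
  Finset.prod_nonneg fun _ _ => sub_nonneg.2 (pow_le_one₀ h0.le h1.le)

theorem gaussNum_le_one (h0 : 0 < x) (h1 : x < 1) (N m : ℕ) : gaussNum x N m ≤ 1 :=
  Finset.prod_le_one (fun _ _ => sub_nonneg.2 (pow_le_one₀ h0.le h1.le))
    fun _ _ => sub_le_self _ (pow_pos h0 _).le

theorem tendsto_gaussNum (h0 : 0 < x) (h1 : x < 1) (m : ℕ) :
    Tendsto (fun N => gaussNum x N m) atTop (𝓝 1) := by
  have : Tendsto (fun N => gaussNum x N m) atTop (𝓝 (∏ _j ∈ Finset.range m, ((1 : ℝ) - 0))) :=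
    tendsto_finsetProd _ fun j _ => tendsto_const_nhds.sub
      ((tendsto_pow_atTop_nhds_zero_of_lt_one h0.le h1).comp (tendsto_sub_atTop_nat j))
  simpa using this

/-- A special case of the `q`-Vandermonde summation. -/
theorem sum_gaussNum (h0 : 0 < x) (h1 : x < 1) (N : ℕ) : ∀ k : ℕ,
    ∑ m ∈ Finset.range (N + 1),
      gaussNum x N m * (x ^ (m * (m + k)) / (qPoch x x m * qPoch x x (m + k))) =
      1 / qPoch x x (N + k) := by
  induction N with
  | zero => intro k; simp [gaussNum, qPoch]
  | succ N ih =>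
    intro k
    have hP := fun n => (qPoch_self_pos h0 h1 n).ne'
    have key : ∀ m ∈ Finset.range (N + 1), gaussNum x (N + 1) (m + 1) *
          (x ^ ((m + 1) * (m + 1 + k)) / (qPoch x x (m + 1) * qPoch x x (m + 1 + k))) =
        gaussNum x N (m + 1) *
          (x ^ ((m + 1) * (m + 1 + k)) / (qPoch x x (m + 1) * qPoch x x (m + 1 + k))) +
        x ^ (N + k + 1) * (gaussNum x N m *
          (x ^ (m * (m + (k + 1))) / (qPoch x x m * qPoch x x (m + (k + 1))))) := by
      intro m hm
      have hm' : m ≤ N := by simpa [Nat.lt_succ_iff] using hm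
      have e : x ^ (N - m) * x ^ ((m + 1) * (m + 1 + k)) =
          x ^ (N + k + 1) * x ^ (m * (m + (k + 1))) := by
        rw [← pow_add, ← pow_add]; congr 1
        obtain ⟨d, rfl⟩ := Nat.exists_eq_add_of_le hm'
        rw [Nat.add_sub_cancel_left]; ring
      have hf : (1 : ℝ) - x ^ (m + 1) ≠ 0 :=
        (sub_pos.2 (pow_lt_one₀ h0.le h1 (by simp))).ne'
      have hs : qPoch x x (m + 1) = qPoch x x m * (1 - x ^ (m + 1)) := by
        rw [qPoch_succ, pow_succ']
      rw [gaussNum_pascal, add_mul, show m + (k + 1) = m + 1 + k by ring, hs]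
      congr 1
      rw [show m + (k + 1) = m + 1 + k by ring] at e
      have h2 := hP m
      have h3 := hP (m + 1 + k)
      field_simp
      linear_combination gaussNum x N m * e
    rw [Finset.sum_range_succ', Finset.sum_congr rfl key, Finset.sum_add_distrib, ← Finset.mul_sum,
      ih (k + 1), add_right_comm]
    have h4 : gaussNum x (N + 1) 0 = gaussNum x N 0 := by simp [gaussNum]
    rw [h4, ← Finset.sum_range_succ' (fun m => gaussNum x N m *
      (x ^ (m * (m + k)) / (qPoch x x m * qPoch x x (m + k)))), Finset.sum_range_succ,
      ih k, gaussNum_eq_zero x (Nat.lt_succ_self N), zero_mul, add_zero,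
      show N + (k + 1) = N + k + 1 by ring, show N + 1 + k = N + k + 1 by ring]
    have hs : qPoch x x (N + k + 1) = qPoch x x (N + k) * (1 - x ^ (N + k + 1)) := by
      rw [qPoch_succ, pow_succ']
    have h5 := hP (N + k)
    have h6 : (1 : ℝ) - x ^ (N + k + 1) ≠ 0 :=
      (sub_pos.2 (pow_lt_one₀ h0.le h1 (by simp))).ne'
    rw [hs]
    field_simp
    ring

theorem summable_durfee (h0 : 0 < x) (h1 : x < 1) (k : ℕ) :
    Summable fun m : ℕ => x ^ (m * (m + k)) / (qPoch x x m * qPoch x x (m + k)) := by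
  have hD := tprod_one_sub_pow_succ_pos h0 h1
  have hle := tprod_le_qPoch_self h0 h1
  set D := ∏' n : ℕ, (1 - x ^ (n + 1))
  have hP := qPoch_self_pos h0 h1
  refine Summable.of_nonneg_of_le (fun m => ?_) (fun m => ?_)
    ((summable_geometric_of_lt_one h0.le h1).div_const (D * D))
  · exact div_nonneg (pow_pos h0 _).le (mul_pos (hP _) (hP _)).le
  · refine div_le_div₀ (pow_pos h0 _).le (pow_le_pow_of_le_one h0.le h1.le ?_) (mul_pos hD hD)
      (mul_le_mul (hle _) (hle _) hD.le (hP _).le)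
    rcases Nat.eq_zero_or_pos m with rfl | h
    · simp
    · exact Nat.le_mul_of_pos_right _ (by omega)

/-- The Durfee rectangle identity. -/
theorem tsum_durfee (h0 : 0 < x) (h1 : x < 1) (k : ℕ) :
    ∑' m : ℕ, x ^ (m * (m + k)) / (qPoch x x m * qPoch x x (m + k)) =
      (∏' n : ℕ, (1 - x ^ (n + 1)))⁻¹ := by
  have hP := qPoch_self_pos h0 h1
  have hpos : ∀ m, 0 ≤ x ^ (m * (m + k)) / (qPoch x x m * qPoch x x (m + k)) := fun m =>
    div_nonneg (pow_pos h0 _).le (mul_pos (hP _) (hP _)).le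
  have lim1 : Tendsto (fun N => ∑' m : ℕ, gaussNum x N m *
      (x ^ (m * (m + k)) / (qPoch x x m * qPoch x x (m + k)))) atTop
      (𝓝 (∑' m : ℕ, x ^ (m * (m + k)) / (qPoch x x m * qPoch x x (m + k)))) := by
    refine tendsto_tsum_of_dominated_convergence (summable_durfee h0 h1 k) (fun m => ?_)
      (Eventually.of_forall fun N m => ?_)
    · simpa using (tendsto_gaussNum h0 h1 m).mul_const
        (x ^ (m * (m + k)) / (qPoch x x m * qPoch x x (m + k)))
    · rw [Real.norm_of_nonneg (mul_nonneg (gaussNum_nonneg h0 h1 N m) (hpos m))]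
      exact mul_le_of_le_one_left (hpos m) (gaussNum_le_one h0 h1 N m)
  have lim2 : Tendsto (fun N => 1 / qPoch x x (N + k)) atTop
      (𝓝 (∏' n : ℕ, (1 - x ^ (n + 1)))⁻¹) := by
    simpa using ((tendsto_qPoch_self h0 h1).comp (tendsto_add_atTop_nat k)).inv₀
      (tprod_one_sub_pow_succ_pos h0 h1).ne'
  refine tendsto_nhds_unique lim1 (lim2.congr fun N => ?_)
  rw [← sum_gaussNum h0 h1 N k, tsum_eq_sum]
  intro m hm
  rw [gaussNum_eq_zero x (by simpa using hm), zero_mul]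

/-- Pairs of naturals of equal parity, parametrised by half their difference and their minimum. -/
def parityEquiv : ℤ × ℕ ≃ {p : ℕ × ℕ // p.1 % 2 = p.2 % 2} where
  toFun a := ⟨(a.2 + 2 * a.1.toNat, a.2 + 2 * (-a.1).toNat), by simp⟩
  invFun p := (((p.1.1 : ℤ) - p.1.2) / 2, min p.1.1 p.1.2)
  left_inv := by
    rintro ⟨n, m⟩
    ext <;> simp only [] <;> omega
  right_inv := by
    rintro ⟨⟨a, b⟩, h⟩
    simp only [] at h
    ext <;> simp only [] <;> omega

theorem summable_rpow_theta {q : ℝ} (h0 : 0 < q) (h1 : q < 1) :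
    Summable fun n : ℤ => q ^ ((3 * (n : ℝ) + 1) ^ 2 / 6) := by
  have hr0 : 0 < q ^ ((1 : ℝ) / 6) := Real.rpow_pos_of_pos h0 _
  have hr1 : q ^ ((1 : ℝ) / 6) < 1 := Real.rpow_lt_one h0.le h1 (by norm_num)
  have hs := summable_geometric_of_lt_one hr0.le hr1
  have hbound : Summable fun n : ℤ => (q ^ ((1 : ℝ) / 6)) ^ n.natAbs :=
    Summable.of_nat_of_neg (by simpa using hs) (by simpa using hs)
  refine Summable.of_nonneg_of_le (fun n => (Real.rpow_pos_of_pos h0 _).le) (fun n => ?_) hbound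
  rw [← Real.rpow_natCast (q ^ ((1 : ℝ) / 6)), ← Real.rpow_mul h0.le]
  refine Real.rpow_le_rpow_of_exponent_ge h0 h1.le ?_
  have hn : |n| ≤ (3 * n + 1) ^ 2 := by
    rcases abs_cases n with h | h <;> rw [h.1] <;> nlinarith
  have : (n.natAbs : ℝ) ≤ (3 * (n : ℝ) + 1) ^ 2 := by
    rw [Nat.cast_natAbs]; exact_mod_cast hn
  linarith

theorem tprod_one_add_mul_tprod_one_sub (h0 : 0 < x) (h1 : x < 1) :
    (∏' n : ℕ, (1 + x ^ (2 * n + 1))) * (∏' n : ℕ, (1 + (x ^ 2) ^ (n + 1))) *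
      ∏' n : ℕ, (1 - x ^ (n + 1)) = ∏' n : ℕ, (1 - (x ^ 2) ^ (n + 1)) := by
  have he : Multipliable fun n : ℕ => 1 + x ^ (2 * n + 1) :=
    Real.multipliable_one_add_of_summable
      ((summable_pow_succ h0 h1).comp_injective (i := fun n : ℕ => 2 * n)
        fun a b h => by simpa using h)
  have ho := multipliable_one_add_pow_succ (pow_pos h0 2) (pow_lt_one₀ h0.le h1 two_ne_zero)
  have hx : ∀ n : ℕ, (x ^ 2) ^ (n + 1) = x ^ (2 * n + 1 + 1) := fun n => by
    rw [← pow_mul]; congr 1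
  have hprod : (∏' n : ℕ, (1 + x ^ (2 * n + 1))) * (∏' n : ℕ, (1 + (x ^ 2) ^ (n + 1))) =
      ∏' n : ℕ, (1 + x ^ (n + 1)) := by
    simp only [hx] at ho ⊢
    exact tprod_even_mul_odd (f := fun n : ℕ => 1 + x ^ (n + 1)) he ho
  rw [hprod, ← (multipliable_one_add_pow_succ h0 h1).tprod_mul
    (multipliable_one_sub_pow_succ h0 h1)]
  exact tprod_congr fun n => by ring

/-- The summand of the double series, in the coordinates of `parityEquiv`. -/
theorem double_series_term (h0 : 0 < x) (h1 : x < 1) (n : ℤ) (m a b : ℕ)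
    (ha : a = m + 2 * n.toNat) (hb : b = m + 2 * (-n).toNat) :
    qPoch (-x) x a * qPoch (-x) x b
        * (x ^ 2) ^ (3 * ((a : ℝ) - (b : ℝ)) ^ 2 / 8 + ((a : ℝ) - (b : ℝ)) / 2
            + (a : ℝ) * (b : ℝ) / 2)
        / (qPoch (x ^ 2) (x ^ 2) a * qPoch (x ^ 2) (x ^ 2) b) =
      (x ^ 2) ^ (((3 * (n : ℝ) + 1) ^ 2 / 6) - 1 / 6) *
        (x ^ (m * (m + 2 * n.natAbs)) / (qPoch x x m * qPoch x x (m + 2 * n.natAbs))) := by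
  have hab : (a : ℝ) - b = 2 * n := by
    have : (a : ℤ) - b = 2 * n := by omega
    exact_mod_cast this
  have hsplit : (a = m + 2 * n.natAbs ∧ b = m) ∨ (a = m ∧ b = m + 2 * n.natAbs) := by omega
  have hmul : a * b = m * (m + 2 * n.natAbs) := by
    rcases hsplit with ⟨h, h'⟩ | ⟨h, h'⟩ <;> rw [h, h'] ; ring
  have hP : qPoch x x a * qPoch x x b = qPoch x x m * qPoch x x (m + 2 * n.natAbs) := by
    rcases hsplit with ⟨h, h'⟩ | ⟨h, h'⟩ <;> rw [h, h'] ; ring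
  rw [← hP, ← hmul, ← qPoch_neg_mul_qPoch, ← qPoch_neg_mul_qPoch, hab,
    show 3 * (2 * (n : ℝ)) ^ 2 / 8 + 2 * n / 2 + (a : ℝ) * b / 2 =
      ((3 * (n : ℝ) + 1) ^ 2 / 6 - 1 / 6) + (a : ℝ) * b / 2 by ring,
    Real.rpow_add (pow_pos h0 2)]
  have hpow : (x ^ 2) ^ ((a : ℝ) * b / 2) = x ^ (a * b) := by
    rw [← Real.rpow_natCast x 2, ← Real.rpow_mul h0.le, ← Real.rpow_natCast]
    congr 1; push_cast; ring
  rw [hpow]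
  have h2 := (qPoch_neg_pos h0 a).ne'
  have h3 := (qPoch_neg_pos h0 b).ne'
  have h4 := (qPoch_self_pos h0 h1 a).ne'
  have h5 := (qPoch_self_pos h0 h1 b).ne'
  field_simp

theorem hasSum_double_series {q : ℝ} (h0 : 0 < x) (h1 : x < 1) (hq : q = x ^ 2) :
    HasSum (fun p : {p : ℕ × ℕ // p.1 % 2 = p.2 % 2} =>
      qPoch (-x) x p.1.1 * qPoch (-x) x p.1.2
        * q ^ (3 * ((p.1.1 : ℝ) - (p.1.2 : ℝ)) ^ 2 / 8
                + ((p.1.1 : ℝ) - (p.1.2 : ℝ)) / 2 + (p.1.1 : ℝ) * (p.1.2 : ℝ) / 2)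
        / (qPoch q q p.1.1 * qPoch q q p.1.2))
      (q ^ (-(1 / 6) : ℝ) * (∑' n : ℤ, q ^ ((3 * (n : ℝ) + 1) ^ 2 / 6)) *
        (∏' n : ℕ, (1 - x ^ (n + 1)))⁻¹) := by
  subst hq
  have hq0 : 0 < x ^ 2 := pow_pos h0 2
  have hP := qPoch_self_pos h0 h1
  have hth := (summable_rpow_theta hq0 (pow_lt_one₀ h0.le h1 two_ne_zero)).mul_left
    ((x ^ 2) ^ (-(1 / 6) : ℝ))
  have hexp : ∀ n : ℤ, (x ^ 2) ^ (-(1 / 6) : ℝ) * (x ^ 2) ^ ((3 * (n : ℝ) + 1) ^ 2 / 6) =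
      (x ^ 2) ^ ((3 * (n : ℝ) + 1) ^ 2 / 6 - 1 / 6) := fun n => by
    rw [← Real.rpow_add hq0]; congr 1; ring
  rw [← tsum_mul_left, ← tsum_mul_right, ← parityEquiv.hasSum_iff]
  simp only [hexp] at hth ⊢
  set g : ℤ × ℕ → ℝ := fun a => (x ^ 2) ^ ((3 * (a.1 : ℝ) + 1) ^ 2 / 6 - 1 / 6) *
    (x ^ (a.2 * (a.2 + 2 * a.1.natAbs)) / (qPoch x x a.2 * qPoch x x (a.2 + 2 * a.1.natAbs)))
    with hg
  have hfg : ∀ n : ℤ, ∑' m : ℕ, g (n, m) = (x ^ 2) ^ ((3 * (n : ℝ) + 1) ^ 2 / 6 - 1 / 6) *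
      (∏' n : ℕ, (1 - x ^ (n + 1)))⁻¹ := fun n => by
    simp only [hg, tsum_mul_left, tsum_durfee h0 h1]
  have hsum : Summable g := by
    refine (summable_prod_of_nonneg fun a => ?_).2 ⟨fun n => ?_, ?_⟩
    · exact mul_nonneg (Real.rpow_pos_of_pos hq0 _).le
        (div_nonneg (pow_pos h0 _).le (mul_pos (hP _) (hP _)).le)
    · exact (summable_durfee h0 h1 (2 * n.natAbs)).mul_left
        ((x ^ 2) ^ ((3 * (n : ℝ) + 1) ^ 2 / 6 - 1 / 6))
    · simp only [hfg]
      exact hth.mul_right _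
  have htot := hsum.hasSum
  rw [hsum.tsum_prod] at htot
  simp only [hfg] at htot
  refine htot.congr_fun fun a => ?_
  exact double_series_term h0 h1 a.1 a.2 _ _ rfl rfl

end QSeries

/-- the fermionic double-sum expression for
`(𝔣(τ)/η(τ))·Θ_{1,3/2}(τ)` (formula (13.8) of the paper), written out in the
variable `q ∈ (0,1)`, together with absolute convergence of all series/products. -/
theorem stmt_15 (q : ℝ) (h0 : 0 < q) (h1 : q < 1) :
    Multipliable (fun n : ℕ => 1 + Real.sqrt q ^ (2 * n + 1))
      ∧ Multipliable (fun n : ℕ => 1 - q ^ (n + 1))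
      ∧ Multipliable (fun n : ℕ => 1 + q ^ (n + 1))
      ∧ Summable (fun n : ℤ => q ^ ((3 * (n : ℝ) + 1) ^ 2 / 6))
      ∧ Summable (fun p : {p : ℕ × ℕ // p.1 % 2 = p.2 % 2} =>
          qPoch (-(Real.sqrt q)) (Real.sqrt q) p.1.1
            * qPoch (-(Real.sqrt q)) (Real.sqrt q) p.1.2
            * q ^ (3 * ((p.1.1 : ℝ) - (p.1.2 : ℝ)) ^ 2 / 8
                    + ((p.1.1 : ℝ) - (p.1.2 : ℝ)) / 2 + (p.1.1 : ℝ) * (p.1.2 : ℝ) / 2)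
            / (qPoch q q p.1.1 * qPoch q q p.1.2))
      ∧ q ^ (-(1 / 16) : ℝ)
          * ((∏' n : ℕ, (1 + Real.sqrt q ^ (2 * n + 1)))
              / ∏' n : ℕ, (1 - q ^ (n + 1)))
          * ∑' n : ℤ, q ^ ((3 * (n : ℝ) + 1) ^ 2 / 6)
        = (q ^ ((5 : ℝ) / 48) / ∏' n : ℕ, (1 + q ^ (n + 1)))
            * ∑' p : {p : ℕ × ℕ // p.1 % 2 = p.2 % 2},
                qPoch (-(Real.sqrt q)) (Real.sqrt q) p.1.1
                  * qPoch (-(Real.sqrt q)) (Real.sqrt q) p.1.2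
                  * q ^ (3 * ((p.1.1 : ℝ) - (p.1.2 : ℝ)) ^ 2 / 8
                          + ((p.1.1 : ℝ) - (p.1.2 : ℝ)) / 2 + (p.1.1 : ℝ) * (p.1.2 : ℝ) / 2)
                  / (qPoch q q p.1.1 * qPoch q q p.1.2) := by
  have hs0 : 0 < Real.sqrt q := Real.sqrt_pos.2 h0
  have hs1 : Real.sqrt q < 1 := by
    rw [Real.sqrt_lt' one_pos]; simpa using h1
  have hq : q = Real.sqrt q ^ 2 := (Real.sq_sqrt h0.le).symm
  have hD := hasSum_double_series hs0 hs1 hq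
  have hprod := tprod_one_add_mul_tprod_one_sub hs0 hs1
  rw [← hq] at hprod
  have hB := tprod_one_sub_pow_succ_pos h0 h1
  refine ⟨Real.multipliable_one_add_of_summable
      ((summable_pow_succ hs0 hs1).comp_injective (i := fun n : ℕ => 2 * n)
        fun a b h => by simpa using h),
    multipliable_one_sub_pow_succ h0 h1, multipliable_one_add_pow_succ h0 h1,
    summable_rpow_theta h0 h1, hD.summable, ?_⟩
  rw [hD.tsum_eq]
  have hpow : q ^ ((5 : ℝ) / 48) * q ^ (-(1 / 6) : ℝ) = q ^ (-(1 / 16) : ℝ) := by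
    rw [← Real.rpow_add h0]; norm_num
  rw [← hpow, ← hprod]
  rw [← hprod] at hB
  have hA := left_ne_zero_of_mul (left_ne_zero_of_mul hB.ne')
  have hC := right_ne_zero_of_mul (left_ne_zero_of_mul hB.ne')
  have hE := right_ne_zero_of_mul hB.ne'
  field_simp
end
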